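/- Let X be a metric space with the property P. If every countably infinite locally finite open cover of X has a Lebesgue number, then X is totally bounded. -/

import Mathlib

open Metric Set

/-- A family `𝒪` of subsets of a metric space `X` is *locally finite* if every point of `X`
has a neighborhood meeting only finitely many members of `𝒪`. -/
def LocallyFiniteFamily {X : Type*} [MetricSpace X] (𝒪 : Set (Set X)) : Prop :=
  ∀ x : X, ∃ U ∈ nhds x, {O ∈ 𝒪 | (O ∩ U).Nonempty}.Finite

/-- `a` is an `ε`-chain of length `n` joining `x` to `y`. -/
def IsEpsChain {X : Type*} [MetricSpace X] (ε : ℝ) (n : ℕ) (a : ℕ → X) (x y : X) : Prop :=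
  a 0 = x ∧ a n = y ∧ ∀ i < n, dist (a i) (a (i + 1)) ≤ ε

/-- A metric space is *chainable* if every pair of points can be joined by an `ε`-chain,
for every `ε > 0`. -/
def Chainable (X : Type*) [MetricSpace X] : Prop :=
  ∀ ε > (0 : ℝ), ∀ x y : X, ∃ n a, IsEpsChain ε n a x y

/-- A metric space is *uniformly chainable* if for each `ε > 0` there is an `n` such that
every pair of points can be joined by an `ε`-chain of length `n`. -/
def UniformlyChainable (X : Type*) [MetricSpace X] : Prop :=
  ∀ ε > (0 : ℝ), ∃ n : ℕ, ∀ x y : X, ∃ a, IsEpsChain ε n a x y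

/-- A metric space is *finitely chainable* if for each `ε > 0` there are finitely many points
`p ∈ P` and an `m ∈ ℕ` such that every point can be joined to some `p ∈ P` by an `ε`-chain
of length `m`. -/
def FinitelyChainable (X : Type*) [MetricSpace X] : Prop :=
  ∀ ε > (0 : ℝ), ∃ (P : Finset X) (m : ℕ), ∀ x : X, ∃ p ∈ P, ∃ a, IsEpsChain ε m a x p

/-- A metric space is *uniformly locally compact* if there is an `ε > 0` such that every
closed ball of radius `ε` is compact. -/
def UniformlyLocallyCompact (X : Type*) [MetricSpace X] : Prop :=
  ∃ ε > (0 : ℝ), ∀ x : X, IsCompact (Metric.closedBall x ε)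

/-- `α` is a *Lebesgue number* for the cover `𝒪` of the set `S`: `α > 0` and every subset
of `S` of diameter `< α` is contained in a single member of `𝒪`. -/
def IsLebesgueNumberFor {X : Type*} [MetricSpace X] (α : ℝ) (𝒪 : Set (Set X)) (S : Set X) :
    Prop :=
  0 < α ∧ ∀ A ⊆ S, EMetric.diam A < ENNReal.ofReal α → ∃ O ∈ 𝒪, A ⊆ O

/-- A metric space is an *Atsuji space* if every open cover of it has a Lebesgue number. -/
def IsAtsuji (X : Type*) [MetricSpace X] : Prop :=
  ∀ 𝒪 : Set (Set X), (∀ O ∈ 𝒪, IsOpen O) → ⋃₀ 𝒪 = Set.univ →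
    ∃ α, IsLebesgueNumberFor α 𝒪 Set.univ

/-- A metric space has *property P* if for every `x` and every real `r` with
`0 ≤ r < sup_{y} d(x, y)` there is a point `z` with `d(x, z) = r`.  (The supremum is taken
in `ℝ≥0∞` so that unbounded spaces are handled correctly.) -/
def PropertyP (X : Type*) [MetricSpace X] : Prop :=
  ∀ (x : X) (r : ℝ), 0 ≤ r → ENNReal.ofReal r < ⨆ y : X, edist x y → ∃ z : X, dist x z = r

/-- A metric space is *Menger convex* if for all `x, y` and `0 ≤ r ≤ d(x, y)` the closed
balls `B[x, r]` and `B[y, d(x, y) - r]` intersect. -/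
def MengerConvex (X : Type*) [MetricSpace X] : Prop :=
  ∀ x y : X, ∀ r : ℝ, 0 ≤ r → r ≤ dist x y →
    ∃ z : X, dist x z ≤ r ∧ dist y z ≤ dist x y - r

/-- A metric space is *metrically convex* if for any two distinct points `x, y` there is a
third point `z` (distinct from both) with `d(x, y) = d(x, z) + d(z, y)`. -/
def MetricallyConvex (X : Type*) [MetricSpace X] : Prop :=
  ∀ x y : X, x ≠ y → ∃ z : X, z ≠ x ∧ z ≠ y ∧ dist x y = dist x z + dist z y

/-- A metric space that is not totally bounded contains a uniformly separated sequence. -/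
theorem exists_separated_seq_of_not_totallyBounded {X : Type*} [MetricSpace X]
    (hX : ¬ TotallyBounded (Set.univ : Set X)) :
    ∃ ε > (0 : ℝ), ∃ x : ℕ → X, ∀ m n, m ≠ n → ε ≤ dist (x m) (x n) := by
  rw [Metric.totallyBounded_iff] at hX
  push Not at hX
  obtain ⟨ε, hε, hcov⟩ := hX
  have hex : ∀ t : Set X, t.Finite → ∃ c, ∀ y ∈ t, ε ≤ dist c y := by
    intro t ht
    obtain ⟨c, -, hc⟩ := Set.not_subset.1 (hcov t ht)
    refine ⟨c, fun y hy => ?_⟩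
    by_contra hlt
    exact hc (Set.mem_biUnion hy (Metric.mem_ball.2 (not_le.1 hlt)))
  obtain ⟨x, hx⟩ := seq_of_forall_finite_exists hex
  refine ⟨ε, hε, x, fun m n hmn => ?_⟩
  rcases lt_or_gt_of_ne hmn with hlt | hlt
  · rw [dist_comm]
    exact hx n _ ⟨m, hlt, rfl⟩
  · exact hx m _ ⟨n, hlt, rfl⟩

/-- If the points of a sequence are at distance at least `ε` from each other, then a ball of
radius `ε / 2` contains at most one of them. -/
theorem eq_of_dist_lt_half_of_separated {X : Type*} [MetricSpace X] {ε : ℝ} {x : ℕ → X}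
    (hx : ∀ m n, m ≠ n → ε ≤ dist (x m) (x n)) {y : X} {m n : ℕ}
    (hm : dist (x m) y < ε / 2) (hn : dist (x n) y < ε / 2) : m = n := by
  by_contra hmn
  have := hx m n hmn
  have := dist_triangle_right (x m) (x n) y
  linarith

/-- Let `X` be a metric space with property `P`. If every countably
infinite locally finite open cover of `X` has a Lebesgue number, then `X` is totally
bounded. -/
theorem statement_18 {X : Type*} [MetricSpace X] (hP : PropertyP X)
    (h : ∀ 𝒪 : Set (Set X), 𝒪.Countable → 𝒪.Infinite → (∀ O ∈ 𝒪, IsOpen O) →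
      ⋃₀ 𝒪 = Set.univ → LocallyFiniteFamily 𝒪 → ∃ α, IsLebesgueNumberFor α 𝒪 Set.univ) :
    TotallyBounded (Set.univ : Set X) := by
  by_contra hX
  obtain ⟨ε, hε, x, hx⟩ := exists_separated_seq_of_not_totallyBounded hX
  obtain ⟨δ, hδ⟩ : ∃ δ : ℕ → ℝ, δ = fun n : ℕ => ε / 4 * (1 / ((n : ℝ) + 1)) := ⟨_, rfl⟩
  have hδ0 : ∀ n, 0 < δ n := fun n => by rw [hδ]; positivity
  have hδle : ∀ n, δ n ≤ ε / 4 := fun n => by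
    rw [hδ]
    have h1 : 1 / ((n : ℝ) + 1) ≤ 1 := by
      rw [div_le_one (by positivity)]
      linarith [(Nat.cast_nonneg n : (0 : ℝ) ≤ n)]
    exact mul_le_of_le_one_right (by positivity) h1
  have hδlim : Filter.Tendsto δ Filter.atTop (nhds 0) := by
    rw [hδ]
    simpa using (tendsto_one_div_add_atTop_nhds_zero_nat (𝕜 := ℝ)).const_mul (ε / 4)
  have hball : ∀ m n, x m ∈ ball (x n) (δ n) → m = n := by
    intro m n hmn
    rw [mem_ball] at hmn
    refine eq_of_dist_lt_half_of_separated hx (y := x n) ?_ ?_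
    · linarith [hδle n]
    · rw [dist_self]
      positivity
  have hinj : Function.Injective fun n => ball (x n) (δ n) := by
    intro m n hmn
    have hmem : x m ∈ ball (x m) (δ m) := mem_ball_self (hδ0 m)
    have hmn' : ball (x m) (δ m) = ball (x n) (δ n) := hmn
    rw [hmn'] at hmem
    exact hball m n hmem
  have hclosed : IsClosed (Set.range x) :=
    Metric.isClosed_of_pairwise_le_dist hε (by
      rintro _ ⟨m, rfl⟩ _ ⟨n, rfl⟩ hmn
      exact hx m n fun hEq => hmn (congrArg x hEq))
  obtain ⟨α, hα, hL⟩ := h (insert (Set.range x)ᶜ (Set.range fun n => ball (x n) (δ n)))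
    ((Set.countable_range _).insert _)
    ((Set.infinite_range_of_injective hinj).mono (Set.subset_insert _ _))
    (by
      rintro O (rfl | ⟨n, rfl⟩)
      · exact hclosed.isOpen_compl
      · exact isOpen_ball)
    (by
      refine Set.eq_univ_of_forall fun y => ?_
      by_cases hy : y ∈ Set.range x
      · obtain ⟨n, rfl⟩ := hy
        exact ⟨_, Or.inr ⟨n, rfl⟩, mem_ball_self (hδ0 n)⟩
      · exact ⟨_, Or.inl rfl, hy⟩)
    (by
      intro y
      refine ⟨ball y (ε / 4), ball_mem_nhds y (by positivity), ?_⟩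
      have hnear : ∀ n, (ball (x n) (δ n) ∩ ball y (ε / 4)).Nonempty →
          dist (x n) y < ε / 2 := by
        rintro n ⟨z, hz, hzy⟩
        rw [mem_ball] at hz hzy
        have := dist_triangle_left (x n) y z
        linarith [hδle n]
      have hsub : {O ∈ Set.range fun n => ball (x n) (δ n) |
          (O ∩ ball y (ε / 4)).Nonempty}.Subsingleton := by
        rintro _ ⟨⟨m, rfl⟩, hm⟩ _ ⟨⟨n, rfl⟩, hn⟩
        rw [eq_of_dist_lt_half_of_separated hx (hnear m hm) (hnear n hn)]
      refine (hsub.finite.insert (Set.range x)ᶜ).subset ?_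
      rintro O ⟨rfl | hO, hne⟩
      · exact Or.inl rfl
      · exact Or.inr ⟨hO, hne⟩)
  obtain ⟨n, hn⟩ := (hδlim.eventually_lt_const hα).exists
  have hsup : ENNReal.ofReal (δ n) < ⨆ y : X, edist (x n) y := by
    refine lt_of_lt_of_le ?_ (le_iSup (fun y => edist (x n) y) (x (n + 1)))
    rw [edist_dist]
    have hsep := hx n (n + 1) (by simp)
    exact (ENNReal.ofReal_lt_ofReal_iff (by linarith)).2 (by linarith [hδle n])
  obtain ⟨z, hz⟩ := hP (x n) (δ n) (hδ0 n).le hsup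
  obtain ⟨O, hO, hAO⟩ := hL {x n, z} (Set.subset_univ _) (by
    show Metric.ediam _ < _
    rw [Metric.ediam_pair, edist_dist, hz]
    exact (ENNReal.ofReal_lt_ofReal_iff hα).2 hn)
  have hxO : x n ∈ O := hAO (by simp)
  have hzO : z ∈ O := hAO (by simp)
  rcases hO with rfl | ⟨m, rfl⟩
  · exact hxO ⟨n, rfl⟩
  · obtain rfl := hball n m hxO
    rw [mem_ball, dist_comm, hz] at hzO
    exact lt_irrefl _ hzO
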